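/- Let Ω ⊂ ℝⁿ be an open set with 0 ∈ ∂Ω. Let u be a function on Ω̄ ∩ B₁(0) that is Lipschitz with constant L, vanishes on ∂Ω ∩ B₁, and satisfies 𝓛u = f weakly in Ω ∩ B₁ for some bounded measurable f. Suppose there is c > 0 such that u(x) ≥ c·dist(x, ∂Ω) for every x ∈ B_{1/2} ∩ Ω. Then there exist constants C > 0 and r₀ > 0, depending only on n, γ, λ, Λ, [A]_{C^{0,γ}}, c, L and ‖f‖∞, such that sup_{B_r(0) ∩ Ω} u ≥ C r for all 0 < r ≤ r₀. -/

import Mathlib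

open Set Filter MeasureTheory Metric Bornology
open scoped Topology RealInnerProductSpace ENNReal NNReal

noncomputable section

/-- Euclidean space `ℝⁿ`. -/
abbrev EucSp (n : ℕ) := EuclideanSpace ℝ (Fin n)

variable {n : ℕ}

/-- Uniform ellipticity of the coefficient field `A` on the set `s`:
`λ|ξ|² ≤ ⟨A(x)ξ, ξ⟩ ≤ Λ|ξ|²`. -/
def IsElliptic (A : EucSp n → (EucSp n →L[ℝ] EucSp n)) (lam Lam : ℝ)
    (s : Set (EucSp n)) : Prop :=
  ∀ x ∈ s, ∀ ξ : EucSp n,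
    lam * ‖ξ‖ ^ 2 ≤ ⟪A x ξ, ξ⟫ ∧ ⟪A x ξ, ξ⟫ ≤ Lam * ‖ξ‖ ^ 2

/-- Symmetry of the coefficient field on `s`. -/
def IsSymmCoeff (A : EucSp n → (EucSp n →L[ℝ] EucSp n)) (s : Set (EucSp n)) : Prop :=
  ∀ x ∈ s, ∀ ξ η : EucSp n, ⟪A x ξ, η⟫ = ⟪ξ, A x η⟫

/-- `A` is Hölder continuous with exponent `γ` and seminorm at most `K` on `s`. -/
def HolderSemi (A : EucSp n → (EucSp n →L[ℝ] EucSp n)) (γ K : ℝ)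
    (s : Set (EucSp n)) : Prop :=
  ∀ x ∈ s, ∀ y ∈ s, ‖A x - A y‖ ≤ K * ‖x - y‖ ^ γ

/-- `v` is locally Lipschitz on the set `s`. -/
def LocLipOn (v : EucSp n → ℝ) (s : Set (EucSp n)) : Prop :=
  ∀ x ∈ s, ∃ K : ℝ≥0, ∃ t ∈ 𝓝[s] x, LipschitzOnWith K v t

/-- A test function for the weak formulation in the open set `D`:
smooth with compact support contained in `D`. -/
def IsTest (D : Set (EucSp n)) (φ : EucSp n → ℝ) : Prop :=
  ContDiff ℝ (⊤ : ℕ∞) φ ∧ HasCompactSupport φ ∧ tsupport φ ⊆ D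

/-- `𝓛 v = div(A ∇ v) = f` weakly in `D`:
`∫_D ⟨A(x)∇v, ∇φ⟩ = −∫_D f φ` for every test function `φ`. -/
def WeakEq (A : EucSp n → (EucSp n →L[ℝ] EucSp n)) (v f : EucSp n → ℝ)
    (D : Set (EucSp n)) : Prop :=
  ∀ φ : EucSp n → ℝ, IsTest D φ →
    ∫ x in D, ⟪A x (gradient v x), gradient φ x⟫ = - ∫ x in D, f x * φ x

/-- `𝓛 v ≥ f` weakly in `D`:
`∫_D ⟨A(x)∇v, ∇φ⟩ ≤ −∫_D f φ` for every nonnegative test function `φ`. -/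
def WeakGe (A : EucSp n → (EucSp n →L[ℝ] EucSp n)) (v f : EucSp n → ℝ)
    (D : Set (EucSp n)) : Prop :=
  ∀ φ : EucSp n → ℝ, IsTest D φ → (∀ x, 0 ≤ φ x) →
    ∫ x in D, ⟪A x (gradient v x), gradient φ x⟫ ≤ - ∫ x in D, f x * φ x

/-- `𝓛 v ≤ f` weakly in `D`:
`∫_D ⟨A(x)∇v, ∇φ⟩ ≥ −∫_D f φ` for every nonnegative test function `φ`. -/
def WeakLe (A : EucSp n → (EucSp n →L[ℝ] EucSp n)) (v f : EucSp n → ℝ)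
    (D : Set (EucSp n)) : Prop :=
  ∀ φ : EucSp n → ℝ, IsTest D φ → (∀ x, 0 ≤ φ x) →
    - ∫ x in D, f x * φ x ≤ ∫ x in D, ⟪A x (gradient v x), gradient φ x⟫

/-- The positive part `v⁺ = max(v, 0)`. -/
def PPart (v : EucSp n → ℝ) : EucSp n → ℝ := fun x => max (v x) 0

/-- The negative part `v⁻ = max(−v, 0)`. -/
def NPart (v : EucSp n → ℝ) : EucSp n → ℝ := fun x => max (-v x) 0

/-- The right-hand side `f·χ_{v<0}`. -/
def ChiNeg (f v : EucSp n → ℝ) : EucSp n → ℝ := fun x => if v x < 0 then f x else 0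

/-- `Ω⁺(v) = {x ∈ Ω : v(x) > 0}`. -/
def plusSet (Ω : Set (EucSp n)) (v : EucSp n → ℝ) : Set (EucSp n) :=
  {x ∈ Ω | 0 < v x}

/-- `Ω⁻(v)` = interior of `{x ∈ Ω : v(x) ≤ 0}`. -/
def minusSet (Ω : Set (EucSp n)) (v : EucSp n → ℝ) : Set (EucSp n) :=
  interior {x ∈ Ω | v x ≤ 0}

/-- The free boundary `F(v) = ∂{v > 0} ∩ Ω`. -/
def freeBdry (Ω : Set (EucSp n)) (v : EucSp n → ℝ) : Set (EucSp n) :=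
  frontier (plusSet Ω v) ∩ Ω

/-- `x₀ ∈ F(v)` is regular from the right, via the touching ball `B(y,r) ⊆ Ω⁺(v)`
with `B̄ ∩ F(v) = {x₀}`. -/
def TouchRight (Ω : Set (EucSp n)) (v : EucSp n → ℝ) (x₀ y : EucSp n) (r : ℝ) : Prop :=
  0 < r ∧ ball y r ⊆ plusSet Ω v ∧ closure (ball y r) ∩ freeBdry Ω v = {x₀}

/-- `x₀ ∈ F(v)` is regular from the left, via the touching ball `B(y,r) ⊆ Ω⁻(v)`
with `B̄ ∩ F(v) = {x₀}`. -/
def TouchLeft (Ω : Set (EucSp n)) (v : EucSp n → ℝ) (x₀ y : EucSp n) (r : ℝ) : Prop :=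
  0 < r ∧ ball y r ⊆ minusSet Ω v ∧ closure (ball y r) ∩ freeBdry Ω v = {x₀}

/-- The unit normal at `x₀` to a ball centered at `y` touching `F(v)` from the
right at `x₀`, pointing towards `Ω⁺(v)`, i.e. into the ball. -/
def nuRight (x₀ y : EucSp n) : EucSp n := ‖y - x₀‖⁻¹ • (y - x₀)

/-- The unit normal at `x₀` to a ball centered at `y` touching `F(v)` from the
left at `x₀`, pointing towards `Ω⁺(v)`, i.e. away from the ball. -/
def nuLeft (x₀ y : EucSp n) : EucSp n := ‖x₀ - y‖⁻¹ • (x₀ - y)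

/-- `v(x) ≤ α⟨x − x₀, ν⟩⁺ + o(|x − x₀|)` as `x → x₀` within `s`. -/
def ExpandLe (v : EucSp n → ℝ) (x₀ ν : EucSp n) (α : ℝ) (s : Set (EucSp n)) : Prop :=
  ∀ ε > (0:ℝ), ∀ᶠ x in 𝓝[s] x₀,
    v x ≤ α * max ⟪x - x₀, ν⟫ 0 + ε * ‖x - x₀‖

/-- `v(x) ≥ α⟨x − x₀, ν⟩⁺ + o(|x − x₀|)` as `x → x₀` within `s`. -/
def ExpandGe (v : EucSp n → ℝ) (x₀ ν : EucSp n) (α : ℝ) (s : Set (EucSp n)) : Prop :=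
  ∀ ε > (0:ℝ), ∀ᶠ x in 𝓝[s] x₀,
    α * max ⟪x - x₀, ν⟫ 0 - ε * ‖x - x₀‖ ≤ v x

/-- `v(x) = o(|x − x₀|)` as `x → x₀` within `s`. -/
def SmallO (v : EucSp n → ℝ) (x₀ : EucSp n) (s : Set (EucSp n)) : Prop :=
  ∀ ε > (0:ℝ), ∀ᶠ x in 𝓝[s] x₀, |v x| ≤ ε * ‖x - x₀‖

/-- The non-tangential cone at `x₀` in direction `ν` with opening parameter `θ`. -/
def ntCone (x₀ ν : EucSp n) (θ : ℝ) : Set (EucSp n) :=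
  {x | θ * ‖x - x₀‖ < ⟪x - x₀, ν⟫}

/-- Hypotheses on the free boundary condition function `G(β, x, ν)`: strictly
increasing in `β ≥ 0`, Lipschitz in all arguments, and
`G(0) := inf_{x ∈ Ω, |ν|=1} G(0, x, ν) ≥ G0 > 0`. -/
def GHyp (Ω : Set (EucSp n)) (G : ℝ → EucSp n → EucSp n → ℝ) (G0 : ℝ) : Prop :=
  (∀ x ν, StrictMonoOn (fun β => G β x ν) (Ici (0:ℝ))) ∧
  (∃ LG : ℝ≥0, LipschitzWith LG (fun p : ℝ × EucSp n × EucSp n => G p.1 p.2.1 p.2.2)) ∧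
  0 < G0 ∧ ∀ x ∈ Ω, ∀ ν : EucSp n, ‖ν‖ = 1 → G0 ≤ G 0 x ν

/-- A (crude) notion of bounded Lipschitz domain: bounded, open, and near every
boundary point, `Ω` is the supergraph of a Lipschitz function in some direction. -/
def IsLipschitzDomain (Ω : Set (EucSp n)) : Prop :=
  IsOpen Ω ∧ IsBounded Ω ∧ Ω.Nonempty ∧
  ∀ x ∈ frontier Ω, ∃ r : ℝ, 0 < r ∧ ∃ (g : EucSp n → ℝ) (L : ℝ≥0) (e : EucSp n),
    ‖e‖ = 1 ∧ LipschitzWith L g ∧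
    ∀ y ∈ ball x r, (y ∈ Ω ↔ g (y - ⟪y, e⟫ • e) < ⟪y, e⟫)

/-- The class `𝓕` of admissible supersolutions (Definition 1.2). -/
def memF (A : EucSp n → (EucSp n →L[ℝ] EucSp n)) (Ω : Set (EucSp n))
    (f₁ f₂ : EucSp n → ℝ) (G : ℝ → EucSp n → EucSp n → ℝ) (w : EucSp n → ℝ) : Prop :=
  ContinuousOn w (closure Ω) ∧ LocLipOn w (closure Ω) ∧
  WeakLe A w f₁ (plusSet Ω w) ∧
  WeakLe A w (ChiNeg f₂ w) (minusSet Ω w) ∧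
  (∀ x₀ y r, TouchLeft Ω w x₀ y r →
    ∃ α β : ℝ, 0 ≤ α ∧ 0 ≤ β ∧
      ExpandLe (PPart w) x₀ (nuLeft x₀ y) α Set.univ ∧
      ExpandGe (NPart w) x₀ (-(nuLeft x₀ y)) β Set.univ ∧
      α < G β x₀ (nuLeft x₀ y)) ∧
  (∀ x₀ ∈ freeBdry Ω w, (∀ y r, ¬ TouchLeft Ω w x₀ y r) → SmallO w x₀ Set.univ)

/-- A minorant (strict subsolution) for the free boundary problem. -/
def IsMinorant (A : EucSp n → (EucSp n →L[ℝ] EucSp n)) (Ω : Set (EucSp n))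
    (f₁ f₂ : EucSp n → ℝ) (G : ℝ → EucSp n → EucSp n → ℝ) (u : EucSp n → ℝ) : Prop :=
  LocLipOn u Ω ∧
  WeakGe A u f₁ (plusSet Ω u) ∧
  WeakGe A u (ChiNeg f₂ u) (minusSet Ω u) ∧
  ∀ x₀ ∈ freeBdry Ω u, ∃ y r, TouchRight Ω u x₀ y r ∧
    ∃ α β : ℝ, 0 ≤ α ∧ 0 ≤ β ∧
      ExpandGe (PPart u) x₀ (nuRight x₀ y) α Set.univ ∧
      ExpandLe (NPart u) x₀ (-(nuRight x₀ y)) β Set.univ ∧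
      G β x₀ (nuRight x₀ y) < α

/-- A weak solution of the two-phase free boundary problem (Definition 1.1). -/
def IsWeakSolution (A : EucSp n → (EucSp n →L[ℝ] EucSp n)) (Ω : Set (EucSp n))
    (f₁ f₂ : EucSp n → ℝ) (G : ℝ → EucSp n → EucSp n → ℝ) (u : EucSp n → ℝ) : Prop :=
  ContinuousOn u Ω ∧
  WeakEq A u f₁ (plusSet Ω u) ∧
  WeakEq A u (ChiNeg f₂ u) (minusSet Ω u) ∧
  (∀ x₀ y r, TouchRight Ω u x₀ y r →
    ∃ α β : ℝ, 0 ≤ α ∧ 0 ≤ β ∧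
      ExpandGe (PPart u) x₀ (nuRight x₀ y) α (ball y r) ∧
      ExpandLe (NPart u) x₀ (-(nuRight x₀ y)) β (closure (ball y r))ᶜ ∧
      (∀ θ ∈ Ioo (0:ℝ) 1,
        SmallO (fun x => PPart u x - α * ⟪x - x₀, nuRight x₀ y⟫) x₀
          (ntCone x₀ (nuRight x₀ y) θ) ∧
        SmallO (fun x => NPart u x - β * ⟪x - x₀, -(nuRight x₀ y)⟫) x₀
          (ntCone x₀ (-(nuRight x₀ y)) θ)) ∧
      α ≤ G β x₀ (nuRight x₀ y)) ∧
  (∀ x₀ y r, TouchLeft Ω u x₀ y r →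
    ∃ α β : ℝ, 0 ≤ α ∧ 0 ≤ β ∧
      ExpandGe (NPart u) x₀ (-(nuLeft x₀ y)) β (ball y r) ∧
      ExpandLe (PPart u) x₀ (nuLeft x₀ y) α (closure (ball y r))ᶜ ∧
      (∀ θ ∈ Ioo (0:ℝ) 1,
        SmallO (fun x => PPart u x - α * ⟪x - x₀, nuLeft x₀ y⟫) x₀
          (ntCone x₀ (nuLeft x₀ y) θ) ∧
        SmallO (fun x => NPart u x - β * ⟪x - x₀, -(nuLeft x₀ y)⟫) x₀
          (ntCone x₀ (-(nuLeft x₀ y)) θ)) ∧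
      G β x₀ (nuLeft x₀ y) ≤ α)

/-- The Perron family: admissible supersolutions above the minorant `ubar`
with boundary values `φb`. -/
def PerronFam (A : EucSp n → (EucSp n →L[ℝ] EucSp n)) (Ω : Set (EucSp n))
    (f₁ f₂ : EucSp n → ℝ) (G : ℝ → EucSp n → EucSp n → ℝ)
    (ubar φb : EucSp n → ℝ) : Set (EucSp n → ℝ) :=
  {w | memF A Ω f₁ f₂ G w ∧ (∀ x ∈ closure Ω, ubar x ≤ w x) ∧
       ∀ x ∈ frontier Ω, w x = φb x}

/-- The smooth radial profile `s ↦ exp(-1/(1-s))`, extended by zero for `s ≥ 1`. -/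
def cap (s : ℝ) : ℝ := expNegInvGlue (1 - s)

/-- The negative of the derivative of `cap`. -/
def capSlope (s : ℝ) : ℝ := (1 - s)⁻¹ ^ 2 * expNegInvGlue (1 - s)

lemma contDiff_cap : ContDiff ℝ (⊤ : ℕ∞) cap :=
  expNegInvGlue.contDiff.comp (contDiff_const.sub contDiff_id)

lemma cap_nonneg (s : ℝ) : 0 ≤ cap s := expNegInvGlue.nonneg _

lemma cap_le_one (s : ℝ) : cap s ≤ 1 := by
  unfold cap expNegInvGlue
  split_ifs with h
  · exact zero_le_one
  · rw [not_le] at h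
    exact Real.exp_le_one_iff.2 (neg_nonpos.2 (inv_nonneg.2 h.le))

lemma cap_eq_zero {s : ℝ} (hs : 1 ≤ s) : cap s = 0 :=
  expNegInvGlue.zero_of_nonpos (by linarith)

lemma hasDerivAt_cap (s : ℝ) : HasDerivAt cap (-capSlope s) s := by
  have h := expNegInvGlue.hasDerivAt_polynomial_eval_inv_mul 1 (1 - s)
  simp only [Polynomial.eval_one, one_mul, Polynomial.derivative_one, sub_zero, mul_one,
    Polynomial.eval_pow, Polynomial.eval_X] at h
  have h2 : HasDerivAt cap _ s := h.comp s ((hasDerivAt_id s).const_sub 1)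
  convert h2 using 1
  simp [capSlope]

lemma continuous_capSlope : Continuous capSlope := by
  have h := expNegInvGlue.continuous_polynomial_eval_inv_mul (Polynomial.X ^ 2)
  have h2 := h.comp (continuous_const.sub continuous_id : Continuous fun s : ℝ => 1 - s)
  convert h2 using 1
  ext s
  simp [capSlope]

lemma capSlope_nonneg (s : ℝ) : 0 ≤ capSlope s :=
  mul_nonneg (sq_nonneg _) (expNegInvGlue.nonneg _)

lemma capSlope_eq_zero {s : ℝ} (hs : 1 ≤ s) : capSlope s = 0 := by
  simp [capSlope, expNegInvGlue.zero_of_nonpos (show 1 - s ≤ 0 by linarith)]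

lemma capSlope_pos {s : ℝ} (hs : s < 1) : 0 < capSlope s :=
  mul_pos (pow_pos (inv_pos.2 (by linarith)) 2) (expNegInvGlue.pos_of_pos (by linarith))

lemma exists_capSlope_le : ∃ b : ℝ, 0 < b ∧ ∀ s, 0 ≤ s → capSlope s ≤ b := by
  obtain ⟨b, hb⟩ := (isCompact_Icc (a := (0 : ℝ)) (b := 1)).bddAbove_image
    continuous_capSlope.continuousOn
  refine ⟨max b 1, by positivity, fun s hs => ?_⟩
  rcases le_total s 1 with h | h
  · exact (hb (mem_image_of_mem _ ⟨hs, h⟩)).trans (le_max_left _ _)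
  · rw [capSlope_eq_zero h]; positivity

lemma exists_le_capSlope {s₁ : ℝ} (h₁ : s₁ < 1) :
    ∃ a : ℝ, 0 < a ∧ ∀ s ∈ Icc 0 s₁, a ≤ capSlope s := by
  rcases lt_or_ge s₁ 0 with h | h
  · exact ⟨1, one_pos, fun s hs => absurd (hs.1.trans hs.2) (not_le.2 h)⟩
  · obtain ⟨s, hs, hmin⟩ := (isCompact_Icc (a := (0 : ℝ)) (b := s₁)).exists_isMinOn
      ⟨0, le_rfl, h⟩ continuous_capSlope.continuousOn
    exact ⟨capSlope s, capSlope_pos (hs.2.trans_lt h₁), fun r hr => hmin hr⟩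

/-- `B` is the inverse of the symmetric elliptic map `A₀`, with the resulting bounds. -/
structure IsFormInverse (A₀ B : EucSp n →L[ℝ] EucSp n) (lam Lam : ℝ) : Prop where
  symm_left : ∀ ξ η, ⟪A₀ ξ, η⟫ = ⟪ξ, A₀ η⟫
  apply_inv : ∀ z, A₀ (B z) = z
  symm : ∀ z w, ⟪B z, w⟫ = ⟪z, B w⟫
  norm_le : ∀ z, ‖B z‖ ≤ ‖z‖ / lam
  sq_le_form : ∀ z, ‖z‖ ^ 2 ≤ Lam * ⟪B z, z⟫

lemma exists_isFormInverse {A₀ : EucSp n →L[ℝ] EucSp n} {lam Lam : ℝ} (hlam : 0 < lam)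
    (hLam : 0 < Lam) (hell : ∀ ξ, lam * ‖ξ‖ ^ 2 ≤ ⟪A₀ ξ, ξ⟫ ∧ ⟪A₀ ξ, ξ⟫ ≤ Lam * ‖ξ‖ ^ 2)
    (hsymm : ∀ ξ η, ⟪A₀ ξ, η⟫ = ⟪ξ, A₀ η⟫) : ∃ B, IsFormInverse A₀ B lam Lam := by
  have hinj : Function.Injective (A₀ : EucSp n →ₗ[ℝ] EucSp n) := by
    rw [← LinearMap.ker_eq_bot, LinearMap.ker_eq_bot']
    intro ξ hξ
    have h := (hell ξ).1
    have h0 : A₀ ξ = 0 := hξ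
    rw [h0, inner_zero_left] at h
    have : ‖ξ‖ ^ 2 = 0 := le_antisymm (by nlinarith [sq_nonneg ‖ξ‖]) (sq_nonneg _)
    simpa using this
  let e := LinearEquiv.ofInjectiveEndo (A₀ : EucSp n →ₗ[ℝ] EucSp n) hinj
  have hinv : ∀ z, A₀ (e.symm z) = z := fun z => e.apply_symm_apply z
  have hnorm : ∀ z, ‖e.symm z‖ ≤ ‖z‖ / lam := by
    intro z
    rw [le_div_iff₀ hlam]
    have h := (hell (e.symm z)).1
    rw [hinv] at h
    have h2 := real_inner_le_norm z (e.symm z)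
    rcases (norm_nonneg (e.symm z)).eq_or_lt with h0 | h0
    · rw [← h0]; simp
    · nlinarith
  refine ⟨(e.symm : EucSp n →ₗ[ℝ] EucSp n).toContinuousLinearMap, hsymm, hinv, ?_, hnorm, ?_⟩
  · intro z w
    change ⟪e.symm z, w⟫ = ⟪z, e.symm w⟫
    conv_lhs => rw [← hinv w]
    rw [← hsymm, hinv]
  · intro z
    change ‖z‖ ^ 2 ≤ Lam * ⟪e.symm z, z⟫
    have h1 := (hell (e.symm z - Lam⁻¹ • z)).1
    have h2 := (hell z).2
    have h3 : ⟪A₀ z, e.symm z⟫ = ‖z‖ ^ 2 := by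
      rw [hsymm, hinv, real_inner_self_eq_norm_sq]
    have h0 : 0 ≤ lam * ‖e.symm z - Lam⁻¹ • z‖ ^ 2 := by positivity
    rw [map_sub, map_smul, hinv, inner_sub_left, inner_sub_right, inner_sub_right,
      inner_smul_left, inner_smul_left, inner_smul_right, inner_smul_right, h3,
      real_inner_self_eq_norm_sq, real_inner_comm] at h1
    simp only [conj_trivial] at h1
    have h4 : Lam⁻¹ * (Lam⁻¹ * ⟪A₀ z, z⟫) ≤ Lam⁻¹ * ‖z‖ ^ 2 := by
      gcongr
      rw [inv_mul_le_iff₀ hLam]; exact h2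
    have h5 : Lam⁻¹ * ‖z‖ ^ 2 ≤ ⟪e.symm z, z⟫ := by linarith
    rwa [inv_mul_le_iff₀ hLam] at h5

namespace IsFormInverse

variable {A₀ B : EucSp n →L[ℝ] EucSp n} {lam Lam : ℝ}

lemma form_le (h : IsFormInverse A₀ B lam Lam) (z : EucSp n) : ⟪B z, z⟫ ≤ ‖z‖ ^ 2 / lam := by
  refine (real_inner_le_norm _ _).trans ?_
  have := mul_le_mul_of_nonneg_right (h.norm_le z) (norm_nonneg z)
  rwa [div_mul_eq_mul_div, ← sq] at this

lemma form_nonneg (h : IsFormInverse A₀ B lam Lam) (hLam : 0 < Lam) (z : EucSp n) :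
    0 ≤ ⟪B z, z⟫ :=
  nonneg_of_mul_nonneg_right ((sq_nonneg _).trans (h.sq_le_form z)) hLam

lemma norm_le_sqrt (h : IsFormInverse A₀ B lam Lam) {z : EucSp n} (hLam : 0 < Lam)
    (hz : ⟪B z, z⟫ ≤ 1) : ‖z‖ ≤ √Lam :=
  Real.le_sqrt_of_sq_le ((h.sq_le_form z).trans (by nlinarith))

lemma capSlope_form_eq_zero (h : IsFormInverse A₀ B lam Lam) {z : EucSp n} (hLam : 0 < Lam)
    (hz : √Lam < ‖z‖) : capSlope ⟪B z, z⟫ = 0 :=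
  capSlope_eq_zero (not_lt.1 fun hlt => absurd (h.norm_le_sqrt hLam hlt.le) (not_le.2 hz))

lemma hasCompactSupport_capSlope (h : IsFormInverse A₀ B lam Lam) (hLam : 0 < Lam) :
    HasCompactSupport fun z => capSlope ⟪B z, z⟫ :=
  HasCompactSupport.intro (isCompact_closedBall 0 √Lam) fun z hz =>
    h.capSlope_form_eq_zero hLam (by simpa using hz)

end IsFormInverse

lemma continuous_capSlope_form (B : EucSp n →L[ℝ] EucSp n) :
    Continuous fun z => capSlope ⟪B z, z⟫ :=
  continuous_capSlope.comp (B.continuous.inner (𝕜 := ℝ) continuous_id)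

lemma measurable_gradient (v : EucSp n → ℝ) : Measurable (gradient v) :=
  (InnerProductSpace.toDual ℝ (EucSp n)).symm.continuous.measurable.comp (measurable_fderiv ℝ v)

lemma norm_gradient_le {v : EucSp n → ℝ} {L : ℝ≥0} (hv : LipschitzWith L v) (y : EucSp n) :
    ‖gradient v y‖ ≤ L := by
  rw [gradient, LinearIsometryEquiv.norm_map]
  exact norm_fderiv_le_of_lipschitz ℝ hv

lemma norm_setIntegral_le_of_eq_zero_off_closedBall {D : Set (EucSp n)} (hD : MeasurableSet D)
    {g : EucSp n → ℝ} {C ρ : ℝ} (hC : 0 ≤ C) {x : EucSp n} (hg : ∀ y ∈ D, |g y| ≤ C)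
    (h0 : ∀ y ∈ D, ρ < dist y x → g y = 0) :
    |∫ y in D, g y| ≤ C * volume.real (closedBall x ρ) := by
  have hi : Integrable ((closedBall x ρ).indicator fun _ => C) :=
    (integrable_indicator_iff measurableSet_closedBall).2
      (integrableOn_const measure_closedBall_lt_top.ne)
  calc |∫ y in D, g y| ≤ ∫ y in D, (closedBall x ρ).indicator (fun _ => C) y := by
        rw [← Real.norm_eq_abs]
        refine norm_integral_le_of_norm_le hi.integrableOn ?_
        filter_upwards [ae_restrict_mem hD] with y hy
        by_cases hyb : y ∈ closedBall x ρ
        · simpa [hyb] using hg y hy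
        · simp [hyb, h0 y hy (by simpa using hyb)]
    _ ≤ ∫ y, (closedBall x ρ).indicator (fun _ => C) y :=
        setIntegral_le_integral hi (Eventually.of_forall fun y => indicator_nonneg (by simp [hC]) y)
    _ = C * volume.real (closedBall x ρ) := by
        rw [integral_indicator measurableSet_closedBall, setIntegral_const, smul_eq_mul, mul_comm]

/-- The average of `v` at scale `t` around `x`, weighted by the profile `capSlope` of the
quadratic form of `B`. -/
def capMean (B : EucSp n →L[ℝ] EucSp n) (v : EucSp n → ℝ) (x : EucSp n) (t : ℝ) : ℝ :=
  ∫ z, v (x + t • z) * capSlope ⟪B z, z⟫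

lemma integrable_mul_capSlope {A₀ B : EucSp n →L[ℝ] EucSp n} {lam Lam : ℝ}
    (hB : IsFormInverse A₀ B lam Lam) (hLam : 0 < Lam) {g : EucSp n → ℝ} (hg : Continuous g) :
    Integrable fun z => g z * capSlope ⟪B z, z⟫ :=
  (hg.mul (continuous_capSlope_form B)).integrable_of_hasCompactSupport
    (hB.hasCompactSupport_capSlope hLam).mul_left

lemma continuous_capMean {A₀ B : EucSp n →L[ℝ] EucSp n} {lam Lam : ℝ}
    (hB : IsFormInverse A₀ B lam Lam) (hLam : 0 < Lam) {v : EucSp n → ℝ} (hv : Continuous v)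
    (x : EucSp n) : Continuous (capMean B v x) := by
  have hk : Continuous (Function.uncurry fun (t : ℝ) (z : EucSp n) =>
      v (x + t • z) * capSlope ⟪B z, z⟫) :=
    (hv.comp (continuous_const.add (continuous_fst.smul continuous_snd))).mul
      ((continuous_capSlope_form B).comp continuous_snd)
  have h := continuous_parametric_integral_of_continuous (μ := volume) hk
    (isCompact_closedBall (0 : EucSp n) √Lam)
  convert h using 2 with t
  refine (setIntegral_eq_integral_of_forall_compl_eq_zero fun z hz => ?_).symm
  rw [hB.capSlope_form_eq_zero hLam (by simpa using hz), mul_zero]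

lemma capMean_zero (B : EucSp n →L[ℝ] EucSp n) (v : EucSp n → ℝ) (x : EucSp n) :
    capMean B v x 0 = v x * ∫ z, capSlope ⟪B z, z⟫ := by
  simp [capMean, integral_const_mul]

lemma ae_differentiableAt_homothety {v : EucSp n → ℝ} {L : ℝ≥0} (hv : LipschitzWith L v)
    (x : EucSp n) {t : ℝ} (ht : t ≠ 0) :
    ∀ᵐ z : EucSp n, DifferentiableAt ℝ v (x + t • z) :=
  ((measurePreserving_add_left volume x).quasiMeasurePreserving.comp
    (Measure.quasiMeasurePreserving_smul volume ht)).ae hv.ae_differentiableAt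

lemma hasDerivAt_capMean {A₀ B : EucSp n →L[ℝ] EucSp n} {lam Lam : ℝ}
    (hB : IsFormInverse A₀ B lam Lam) (hLam : 0 < Lam) {v : EucSp n → ℝ} {L : ℝ≥0}
    (hv : LipschitzWith L v) (x : EucSp n) {t : ℝ} (ht : t ≠ 0) :
    HasDerivAt (capMean B v x)
      (∫ z, ⟪gradient v (x + t • z), z⟫ * capSlope ⟪B z, z⟫) t := by
  have hc : ∀ s : ℝ, Continuous fun z => v (x + s • z) := fun s =>
    hv.continuous.comp (continuous_const.add (continuous_const_smul s))
  refine (hasDerivAt_integral_of_dominated_loc_of_lip (s := univ)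
    (bound := fun z => L * ‖z‖ * capSlope ⟪B z, z⟫) univ_mem
    (Eventually.of_forall fun s => (integrable_mul_capSlope hB hLam (hc s)).aestronglyMeasurable)
    (integrable_mul_capSlope hB hLam (hc t)) ?_ (Eventually.of_forall fun z => ?_)
    (integrable_mul_capSlope hB hLam (continuous_const.mul continuous_norm)) ?_).2
  · refine Measurable.aestronglyMeasurable ?_
    refine Measurable.mul ?_ (continuous_capSlope_form B).measurable
    exact ((measurable_gradient v).comp ((continuous_const.add
      (continuous_const_smul t)).measurable)).inner measurable_id
  · refine LipschitzOnWith.of_dist_le_mul fun a _ b _ => ?_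
    have h1 := hv.dist_le_mul (x + a • z) (x + b • z)
    have h0 := capSlope_nonneg ⟪B z, z⟫
    rw [Real.coe_nnabs, abs_of_nonneg (by positivity), Real.dist_eq, ← sub_mul, abs_mul,
      abs_of_nonneg h0, ← Real.dist_eq]
    rw [dist_add_left, dist_eq_norm (a • z), ← sub_smul, norm_smul, ← dist_eq_norm] at h1
    calc _ ≤ (L * (dist a b * ‖z‖)) * capSlope ⟪B z, z⟫ := by gcongr
      _ = _ := by ring
  · filter_upwards [ae_differentiableAt_homothety hv x ht] with z hz
    have h1 : HasDerivAt (fun s : ℝ => x + s • z) z t := by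
      simpa using ((hasDerivAt_id t).smul_const z).const_add x
    have h2 := hz.hasFDerivAt.comp_hasDerivAt t h1
    rw [← inner_gradient_left] at h2
    exact h2.mul_const _

/-- The test function generated by `cap` at centre `x` and scale `t`. -/
def capTest (B : EucSp n →L[ℝ] EucSp n) (x : EucSp n) (t : ℝ) (y : EucSp n) : ℝ :=
  cap ⟪B (t⁻¹ • (y - x)), t⁻¹ • (y - x)⟫

lemma contDiff_capTest (B : EucSp n →L[ℝ] EucSp n) (x : EucSp n) (t : ℝ) :
    ContDiff ℝ (⊤ : ℕ∞) (capTest B x t) := by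
  have h : ContDiff ℝ (⊤ : ℕ∞) fun y : EucSp n => t⁻¹ • (y - x) :=
    (contDiff_id.sub contDiff_const).const_smul t⁻¹
  exact contDiff_cap.comp ((B.contDiff.comp h).inner ℝ h)

lemma gradient_capTest {A₀ B : EucSp n →L[ℝ] EucSp n} {lam Lam : ℝ}
    (hB : IsFormInverse A₀ B lam Lam) (x : EucSp n) (t : ℝ) (y : EucSp n) :
    gradient (capTest B x t) y =
      -(2 * t⁻¹ * capSlope ⟪B (t⁻¹ • (y - x)), t⁻¹ • (y - x)⟫) • B (t⁻¹ • (y - x)) := by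
  set w := t⁻¹ • (y - x) with hw
  have h1 : HasFDerivAt (fun y : EucSp n => t⁻¹ • (y - x))
      (t⁻¹ • ContinuousLinearMap.id ℝ (EucSp n)) y :=
    ((hasFDerivAt_id y).sub_const x).const_smul t⁻¹
  have h2 := (B.hasFDerivAt.comp y h1).inner ℝ h1
  have h3 := (hasDerivAt_cap ⟪B w, w⟫).comp_hasFDerivAt y h2
  refine HasGradientAt.gradient ?_
  rw [hasGradientAt_iff_hasFDerivAt]
  refine h3.congr_fderiv ?_
  ext ξ
  have h4 := hB.symm ξ w
  have h5 := real_inner_comm ξ (B w)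
  simp [← hw, inner_smul_left, inner_smul_right, h4]
  rw [h5]
  ring

lemma capTest_eq_zero {A₀ B : EucSp n →L[ℝ] EucSp n} {lam Lam : ℝ}
    (hB : IsFormInverse A₀ B lam Lam) (hLam : 0 < Lam) {x y : EucSp n} {t : ℝ} (ht : 0 < t)
    (hy : t * √Lam < dist y x) : capTest B x t y = 0 := by
  refine cap_eq_zero (not_lt.1 fun hlt => ?_)
  have h := hB.norm_le_sqrt hLam hlt.le
  rw [norm_smul, norm_inv, Real.norm_of_nonneg ht.le, inv_mul_le_iff₀ ht, ← dist_eq_norm] at h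
  linarith

lemma gradient_capTest_eq_zero {A₀ B : EucSp n →L[ℝ] EucSp n} {lam Lam : ℝ}
    (hB : IsFormInverse A₀ B lam Lam) (hLam : 0 < Lam) {x y : EucSp n} {t : ℝ} (ht : 0 < t)
    (hy : t * √Lam < dist y x) : gradient (capTest B x t) y = 0 := by
  rw [gradient_capTest hB, capSlope_eq_zero (not_lt.1 fun hlt => ?_)]
  · simp
  have h := hB.norm_le_sqrt hLam hlt.le
  rw [norm_smul, norm_inv, Real.norm_of_nonneg ht.le, inv_mul_le_iff₀ ht, ← dist_eq_norm] at h
  linarith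

lemma norm_gradient_capTest_le {A₀ B : EucSp n →L[ℝ] EucSp n} {lam Lam b : ℝ}
    (hB : IsFormInverse A₀ B lam Lam) (hlam : 0 < lam) (hLam : 0 < Lam) (hb0 : 0 ≤ b)
    (hb : ∀ s, 0 ≤ s → capSlope s ≤ b) {t : ℝ} (ht : 0 < t) (x y : EucSp n) :
    ‖gradient (capTest B x t) y‖ ≤ 2 * t⁻¹ * b * (√Lam / lam) := by
  set w := t⁻¹ • (y - x) with hw
  by_cases h1 : ⟪B w, w⟫ ≤ 1
  · have h2 := hb _ (hB.form_nonneg hLam w)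
    have h3 := capSlope_nonneg ⟪B w, w⟫
    have h4 : ‖B w‖ ≤ √Lam / lam := (hB.norm_le w).trans (by
      gcongr; exact hB.norm_le_sqrt hLam h1)
    rw [gradient_capTest hB, ← hw, norm_smul, norm_neg, Real.norm_of_nonneg (by positivity)]
    gcongr
  · rw [gradient_capTest hB, ← hw, capSlope_eq_zero (not_le.1 h1).le]
    simp only [mul_zero, neg_zero, zero_smul, norm_zero]
    positivity

lemma tsupport_capTest_subset (B : EucSp n →L[ℝ] EucSp n) (x : EucSp n) (t : ℝ) :
    tsupport (capTest B x t) ⊆ {y | ⟪B (t⁻¹ • (y - x)), t⁻¹ • (y - x)⟫ ≤ 1} := by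
  have hc : Continuous fun y : EucSp n => t⁻¹ • (y - x) :=
    (continuous_id.sub continuous_const).const_smul t⁻¹
  refine closure_minimal (fun y hy => not_lt.1 fun hlt => hy (cap_eq_zero hlt.le)) ?_
  exact isClosed_le ((B.continuous.comp hc).inner hc) continuous_const

lemma integral_gradient_capTest {A₀ B : EucSp n →L[ℝ] EucSp n} {lam Lam : ℝ}
    (hB : IsFormInverse A₀ B lam Lam) (v : EucSp n → ℝ) (x : EucSp n) {t : ℝ} (ht : 0 < t) :
    ∫ z, ⟪gradient v (x + t • z), z⟫ * capSlope ⟪B z, z⟫ =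
      -(t / 2 * (t ^ n)⁻¹ * ∫ y, ⟪A₀ (gradient v y), gradient (capTest B x t) y⟫) := by
  have h1 : ∀ z, ⟪gradient v (x + t • z), z⟫ * capSlope ⟪B z, z⟫ = -(t / 2) *
      ⟪A₀ (gradient v (x + t • z)), gradient (capTest B x t) (x + t • z)⟫ := by
    intro z
    rw [gradient_capTest hB, hB.symm_left, map_smul, hB.apply_inv, add_sub_cancel_left,
      inv_smul_smul₀ ht.ne', inner_smul_right]
    field_simp
  simp_rw [h1]
  rw [integral_const_mul, Measure.integral_comp_smul_of_nonneg volume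
    (fun z => ⟪A₀ (gradient v (x + z)), gradient (capTest B x t) (x + z)⟫) t (hR := ht.le),
    integral_add_left_eq_self (fun z => ⟪A₀ (gradient v z), gradient (capTest B x t) z⟫) x]
  simp
  ring

/-- The constant in the mean value estimate for `capMean`. -/
def capConst (n : ℕ) (γ lam Lam K L M b : ℝ) : ℝ :=
  volume.real (closedBall (0 : EucSp n) √Lam) *
    (M + K * √Lam ^ γ * L * (b * (√Lam / lam)))

lemma abs_deriv_capMean_le {A : EucSp n → (EucSp n →L[ℝ] EucSp n)} {B : EucSp n →L[ℝ] EucSp n}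
    {γ lam Lam K M b R t : ℝ} {L : ℝ≥0} {D : Set (EucSp n)} {f v : EucSp n → ℝ} {x : EucSp n}
    (hγ : γ ∈ Ioo (0 : ℝ) 1) (hlam : 0 < lam) (hLam : 0 < Lam) (hK : 0 ≤ K) (hM : 0 ≤ M)
    (hb0 : 0 ≤ b) (hb : ∀ s, 0 ≤ s → capSlope s ≤ b)
    (hD : IsOpen D) (hDb : IsBounded D) (hA : ContinuousOn A D)
    (hAx : ∀ y ∈ D, ‖A y - A x‖ ≤ K * ‖y - x‖ ^ γ) (hB : IsFormInverse (A x) B lam Lam)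
    (hv : LipschitzWith L v) (hf : ∀ y ∈ D, |f y| ≤ M) (hw : WeakEq A v f D)
    (hR : {y | ⟪B (y - x), y - x⟫ < R ^ 2} ⊆ D) (ht : 0 < t) (htR : t < R) (ht1 : t ≤ 1) :
    |∫ z, ⟪gradient v (x + t • z), z⟫ * capSlope ⟪B z, z⟫| ≤
      capConst n γ lam Lam K L M b * t ^ γ := by
  set V := volume.real (closedBall (0 : EucSp n) √Lam) with hV
  set ψ := capTest B x t with hψ
  set G := 2 * t⁻¹ * b * (√Lam / lam) with hG
  have hG0 : 0 ≤ G := by positivity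
  have hgrad : ∀ y, ‖gradient ψ y‖ ≤ G := norm_gradient_capTest_le hB hlam hLam hb0 hb ht x
  have hts : tsupport ψ ⊆ D := by
    refine (tsupport_capTest_subset B x t).trans (Subset.trans (fun y hy => ?_) hR)
    rw [mem_ofPred_eq, map_smul, inner_smul_left, inner_smul_right, conj_trivial, ← mul_assoc,
      ← sq, inv_pow, inv_mul_le_iff₀ (by positivity), mul_one] at hy
    exact hy.trans_lt (by gcongr)
  have htest : IsTest D ψ := by
    refine ⟨contDiff_capTest B x t, HasCompactSupport.intro
      (isCompact_closedBall x (t * √Lam)) fun y hy => ?_, hts⟩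
    exact capTest_eq_zero hB hLam ht (by simpa using hy)
  have hvol : volume.real (closedBall x (t * √Lam)) = t ^ n * V := by
    rw [hV, Measure.real, Measure.addHaar_closedBall_mul_of_pos volume x ht, ENNReal.toReal_mul,
      ENNReal.toReal_ofReal (by positivity), finrank_euclideanSpace_fin, Measure.real]
  have hgm : Measurable (gradient ψ) := measurable_gradient ψ
  have hDf : volume D ≠ ∞ := hDb.measure_lt_top.ne
  have hint : ∀ {P : EucSp n → (EucSp n →L[ℝ] EucSp n)} {c : ℝ}, ContinuousOn P D →
      (∀ y ∈ D, |⟪P y (gradient v y), gradient ψ y⟫| ≤ c) →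
      IntegrableOn (fun y => ⟪P y (gradient v y), gradient ψ y⟫) D := by
    intro P c hP hc
    refine IntegrableOn.of_bound hDf.lt_top ?_ c ?_
    · have h1 := hP.aestronglyMeasurable (μ := volume) hD.measurableSet
      have h2 : AEStronglyMeasurable (gradient v) (volume.restrict D) :=
        (measurable_gradient v).aestronglyMeasurable
      have h3 : AEStronglyMeasurable (fun y => P y (gradient v y)) (volume.restrict D) :=
        isBoundedBilinearMap_apply.continuous.comp_aestronglyMeasurable (h1.prodMk h2)
      exact h3.inner hgm.aestronglyMeasurable
    · filter_upwards [ae_restrict_mem hD.measurableSet] with y hy using hc y hy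
  have hdiff : ∀ y ∈ D, |⟪(A y - A x) (gradient v y), gradient ψ y⟫| ≤
      K * (t * √Lam) ^ γ * L * G := by
    intro y hy
    by_cases hyt : t * √Lam < dist y x
    · rw [gradient_capTest_eq_zero hB hLam ht hyt, inner_zero_right, abs_zero]
      positivity
    · have h1 : ‖y - x‖ ^ γ ≤ (t * √Lam) ^ γ :=
        Real.rpow_le_rpow (norm_nonneg _) (by rw [← dist_eq_norm]; exact not_lt.1 hyt) hγ.1.le
      calc _ ≤ ‖(A y - A x) (gradient v y)‖ * ‖gradient ψ y‖ := abs_real_inner_le_norm _ _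
        _ ≤ ‖A y - A x‖ * ‖gradient v y‖ * ‖gradient ψ y‖ := by
          gcongr; exact (A y - A x).le_opNorm _
        _ ≤ K * (t * √Lam) ^ γ * L * G := by
          gcongr
          · exact (hAx y hy).trans (by gcongr)
          · exact norm_gradient_le hv y
          · exact hgrad y
  have hconst : ∀ y ∈ D, |⟪A x (gradient v y), gradient ψ y⟫| ≤ ‖A x‖ * L * G := by
    intro y _
    calc _ ≤ ‖A x (gradient v y)‖ * ‖gradient ψ y‖ := abs_real_inner_le_norm _ _
      _ ≤ ‖A x‖ * ‖gradient v y‖ * ‖gradient ψ y‖ := by gcongr; exact (A x).le_opNorm _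
      _ ≤ _ := by gcongr; exacts [norm_gradient_le hv y, hgrad y]
  have hsum : ∫ y in D, ⟪A x (gradient v y), gradient ψ y⟫ =
      -(∫ y in D, f y * ψ y) - ∫ y in D, ⟪(A y - A x) (gradient v y), gradient ψ y⟫ := by
    have h1 := integral_add (hint (P := fun _ => A x) continuousOn_const hconst)
      (hint (P := fun y => A y - A x) (hA.sub continuousOn_const) hdiff)
    have h2 := hw ψ htest
    have h3 : ∀ y, ⟪A y (gradient v y), gradient ψ y⟫ = ⟪A x (gradient v y), gradient ψ y⟫ +
        ⟪(A y - A x) (gradient v y), gradient ψ y⟫ := fun y => by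
      rw [← inner_add_left, sub_apply, add_sub_cancel]
    simp_rw [h3] at h2
    linarith
  have hb1 : |∫ y in D, f y * ψ y| ≤ M * (t ^ n * V) := by
    rw [← hvol]
    refine norm_setIntegral_le_of_eq_zero_off_closedBall hD.measurableSet hM
      (fun y hy => ?_) (fun y _ hy => ?_)
    · rw [abs_mul, abs_of_nonneg (show 0 ≤ ψ y from cap_nonneg _)]
      exact (mul_le_mul (hf y hy) (cap_le_one _) (cap_nonneg _) hM).trans (mul_one M).le
    · rw [show ψ y = 0 from capTest_eq_zero hB hLam ht hy, mul_zero]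
  have hb2 : |∫ y in D, ⟪(A y - A x) (gradient v y), gradient ψ y⟫| ≤
      K * (t * √Lam) ^ γ * L * G * (t ^ n * V) := by
    rw [← hvol]
    refine norm_setIntegral_le_of_eq_zero_off_closedBall hD.measurableSet (by positivity)
      hdiff (fun y _ hy => ?_)
    rw [gradient_capTest_eq_zero hB hLam ht hy, inner_zero_right]
  have hfull : ∫ y, ⟪A x (gradient v y), gradient ψ y⟫ =
      ∫ y in D, ⟪A x (gradient v y), gradient ψ y⟫ := by
    refine (setIntegral_eq_integral_of_forall_compl_eq_zero fun y hy => ?_).symm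
    have h0 : fderiv ℝ ψ y = 0 := by
      by_contra h
      exact hy (hts (support_fderiv_subset ℝ h))
    rw [show gradient ψ y = 0 by rw [gradient, h0, map_zero], inner_zero_right]
  rw [integral_gradient_capTest hB v x ht, hfull, hsum, abs_neg, abs_mul,
    abs_of_nonneg (by positivity)]
  have htγ : t ≤ t ^ γ := by
    simpa using Real.rpow_le_rpow_of_exponent_ge ht ht1 hγ.2.le
  have hV0 : 0 ≤ V := measureReal_nonneg
  calc _ ≤ t / 2 * (t ^ n)⁻¹ * (M * (t ^ n * V) + K * (t * √Lam) ^ γ * L * G * (t ^ n * V)) := by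
        gcongr
        refine (abs_sub _ _).trans ?_
        rw [abs_neg]
        exact add_le_add hb1 hb2
    _ = V * (M * (t / 2) + K * √Lam ^ γ * L * (b * (√Lam / lam)) * t ^ γ) := by
        rw [hG, Real.mul_rpow ht.le (Real.sqrt_nonneg _)]
        field_simp
    _ ≤ V * (M * t ^ γ + K * √Lam ^ γ * L * (b * (√Lam / lam)) * t ^ γ) := by
        gcongr; linarith
    _ = _ := by rw [capConst]; ring

lemma abs_capMean_sub_le {A : EucSp n → (EucSp n →L[ℝ] EucSp n)} {B : EucSp n →L[ℝ] EucSp n}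
    {γ lam Lam K M b R t : ℝ} {L : ℝ≥0} {D : Set (EucSp n)} {f v : EucSp n → ℝ} {x : EucSp n}
    (hγ : γ ∈ Ioo (0 : ℝ) 1) (hlam : 0 < lam) (hLam : 0 < Lam) (hK : 0 ≤ K) (hM : 0 ≤ M)
    (hb0 : 0 ≤ b) (hb : ∀ s, 0 ≤ s → capSlope s ≤ b)
    (hD : IsOpen D) (hDb : IsBounded D) (hA : ContinuousOn A D)
    (hAx : ∀ y ∈ D, ‖A y - A x‖ ≤ K * ‖y - x‖ ^ γ) (hB : IsFormInverse (A x) B lam Lam)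
    (hv : LipschitzWith L v) (hf : ∀ y ∈ D, |f y| ≤ M) (hw : WeakEq A v f D)
    (hR : {y | ⟪B (y - x), y - x⟫ < R ^ 2} ⊆ D) (ht : 0 < t) (htR : t < R) (ht1 : t ≤ 1) :
    |capMean B v x t - v x * ∫ z, capSlope ⟪B z, z⟫| ≤
      capConst n γ lam Lam K L M b * t ^ γ * t := by
  obtain ⟨s, hs, hslope⟩ := exists_hasDerivAt_eq_slope (capMean B v x)
    (fun s => ∫ z, ⟪gradient v (x + s • z), z⟫ * capSlope ⟪B z, z⟫) ht
    (continuous_capMean hB hLam hv.continuous x).continuousOn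
    fun s hs => hasDerivAt_capMean hB hLam hv x hs.1.ne'
  have h1 := abs_deriv_capMean_le hγ hlam hLam hK hM hb0 hb hD hDb hA hAx hB hv hf hw hR hs.1
    (hs.2.trans htR) (hs.2.le.trans ht1)
  rw [hslope, capMean_zero, sub_zero, abs_div, abs_of_pos ht, div_le_iff₀ ht] at h1
  refine h1.trans ?_
  have hC : 0 ≤ capConst n γ lam Lam K L M b := by
    have : 0 ≤ volume.real (closedBall (0 : EucSp n) √Lam) := measureReal_nonneg
    unfold capConst; positivity
  gcongr
  exacts [hs.1.le, hγ.1.le, hs.2.le]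
lemma IsPreconnected.inter_frontier_nonempty {X : Type*} [TopologicalSpace X] {S u : Set X}
    (hS : IsPreconnected S) (hu : (S ∩ u).Nonempty) (hc : (S ∩ uᶜ).Nonempty) :
    (S ∩ frontier u).Nonempty := by
  by_contra hne
  have hf : ∀ z ∈ S, z ∉ frontier u := fun z hz hzf => hne ⟨z, hz, hzf⟩
  obtain ⟨a, haS, ha⟩ := hu
  obtain ⟨b, hbS, hb⟩ := hc
  have hin : ∀ z ∈ S, z ∈ closure u → z ∈ interior u := fun z hz hzc => by
    by_contra hzi
    exact hf z hz ⟨hzc, hzi⟩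
  obtain ⟨z, -, hz1, hz2⟩ := hS (interior u) (closure u)ᶜ isOpen_interior
    isClosed_closure.isOpen_compl
    (fun z hz => (em (z ∈ closure u)).imp (hin z hz) id)
    ⟨a, haS, hin a haS (subset_closure ha)⟩
    ⟨b, hbS, fun h => hb (interior_subset (hin b hbS h))⟩
  exact hz2 (interior_subset_closure hz1)

lemma capMean_le {A₀ B : EucSp n →L[ℝ] EucSp n} {lam Lam : ℝ} (hB : IsFormInverse A₀ B lam Lam)
    (hLam : 0 < Lam) {v : EucSp n → ℝ} (hv : Continuous v) {x p : EucSp n} {t τ U m a : ℝ}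
    (hm : 0 ≤ m) (hU : ∀ z, ⟪B z, z⟫ < 1 → v (x + t • z) ≤ U)
    (hp : ∀ z ∈ ball p τ, v (x + t • z) ≤ U - m) (ha : ∀ z ∈ ball p τ, a ≤ capSlope ⟪B z, z⟫) :
    capMean B v x t ≤ U * (∫ z, capSlope ⟪B z, z⟫) - m * a * volume.real (ball (0 : EucSp n) τ) := by
  have hi : Integrable ((ball p τ).indicator fun _ : EucSp n => m * a) :=
    (integrable_indicator_iff measurableSet_ball).2 (integrableOn_const measure_ball_lt_top.ne)
  have hi2 := integrable_mul_capSlope hB hLam (continuous_const (y := U))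
  have hvol : volume.real (ball p τ) = volume.real (ball (0 : EucSp n) τ) := by
    rw [Measure.real, Measure.real, Measure.addHaar_ball_center]
  have h : ∫ z, (U * capSlope ⟪B z, z⟫ - (ball p τ).indicator (fun _ => m * a) z) =
      U * (∫ z, capSlope ⟪B z, z⟫) - m * a * volume.real (ball (0 : EucSp n) τ) := by
    rw [integral_sub hi2 hi, integral_const_mul, integral_indicator measurableSet_ball,
      setIntegral_const, smul_eq_mul, hvol]
    ring
  rw [← h]
  refine integral_mono (integrable_mul_capSlope hB hLam
    (hv.comp (continuous_const.add (continuous_const_smul t)))) (hi2.sub hi) fun z => ?_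
  have h0 := capSlope_nonneg ⟪B z, z⟫
  by_cases hz : z ∈ ball p τ
  · simp only [indicator_of_mem hz]
    nlinarith [hp z hz, ha z hz, mul_le_mul_of_nonneg_right (hp z hz) h0,
      mul_le_mul_of_nonneg_left (ha z hz) hm]
  · simp only [indicator_of_notMem hz, sub_zero]
    rcases lt_or_ge ⟪B z, z⟫ 1 with h1 | h1
    · exact mul_le_mul_of_nonneg_right (hU z h1) h0
    · simp [capSlope_eq_zero h1]

lemma integral_capSlope_le {A₀ B : EucSp n →L[ℝ] EucSp n} {lam Lam b : ℝ}
    (hB : IsFormInverse A₀ B lam Lam) (hLam : 0 < Lam) (hb0 : 0 ≤ b)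
    (hb : ∀ s, 0 ≤ s → capSlope s ≤ b) :
    ∫ z, capSlope ⟪B z, z⟫ ≤ b * volume.real (closedBall (0 : EucSp n) √Lam) := by
  have h := norm_setIntegral_le_of_eq_zero_off_closedBall (x := 0) (ρ := √Lam) MeasurableSet.univ
    hb0 (g := fun z => capSlope ⟪B z, z⟫)
    (fun z _ => by
      rw [abs_of_nonneg (capSlope_nonneg _)]; exact hb _ (hB.form_nonneg hLam z))
    (fun z _ hz => hB.capSlope_form_eq_zero hLam (by simpa using hz))
  rw [setIntegral_univ] at h
  exact (le_abs_self _).trans h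

lemma form_smul (B : EucSp n →L[ℝ] EucSp n) (t : ℝ) (z : EucSp n) :
    ⟪B (t • z), t • z⟫ = t ^ 2 * ⟪B z, z⟫ := by
  rw [map_smul, inner_smul_left, inner_smul_right, conj_trivial]; ring

/-- The largest ellipsoid around `x` contained in `Ω`, with a touching boundary point. -/
lemma exists_touching_ellipsoid {A₀ B : EucSp n →L[ℝ] EucSp n} {lam Lam : ℝ}
    (hB : IsFormInverse A₀ B lam Lam) (hLam : 0 < Lam) {Ω : Set (EucSp n)} (hΩ : IsOpen Ω)
    (hne : (frontier Ω).Nonempty) {x : EucSp n} (hx : x ∈ Ω) :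
    ∃ d > 0, ∃ y ∈ frontier Ω, ⟪B (y - x), y - x⟫ = d ^ 2 ∧
      (∀ w ∈ frontier Ω, d ^ 2 ≤ ⟪B (w - x), w - x⟫) ∧
      {w | ⟪B (w - x), w - x⟫ < d ^ 2} ⊆ Ω := by
  obtain ⟨w₀, hw₀⟩ := hne
  have hcs : Continuous fun y : EucSp n => y - x := continuous_id.sub continuous_const
  have hc : Continuous fun y => ⟪B (y - x), y - x⟫ := (B.continuous.comp hcs).inner hcs
  obtain ⟨y, hy, hmin⟩ := hc.continuousOn.exists_isMinOn' isClosed_frontier hw₀ (by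
    have ht := tendsto_dist_right_cocompact_atTop x
    refine Filter.Eventually.filter_mono inf_le_left ?_
    filter_upwards [ht.eventually_ge_atTop (1 + Lam * ⟪B (w₀ - x), w₀ - x⟫)] with w hw
    have h0 := hB.form_nonneg hLam (w₀ - x)
    have h1 := hB.sq_le_form (w - x)
    rw [dist_eq_norm] at hw
    refine le_of_mul_le_mul_left ?_ hLam
    nlinarith [mul_nonneg hLam.le h0])
  have hxf : ∀ w ∈ frontier Ω, w ≠ x := by
    rintro w hw rfl
    rw [hΩ.frontier_eq] at hw
    exact hw.2 hx
  have hpos : 0 < ⟪B (y - x), y - x⟫ := by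
    have h1 := hB.sq_le_form (y - x)
    have h2 : 0 < ‖y - x‖ := norm_pos_iff.2 (sub_ne_zero.2 (hxf y hy))
    exact pos_of_mul_pos_right ((pow_pos h2 2).trans_le h1) hLam.le
  refine ⟨√⟪B (y - x), y - x⟫, Real.sqrt_pos.2 hpos, y, hy, (Real.sq_sqrt hpos.le).symm, ?_, ?_⟩
  · rw [Real.sq_sqrt hpos.le]
    exact fun w hw => hmin hw
  · rw [Real.sq_sqrt hpos.le]
    intro w hw
    by_contra hwΩ
    obtain ⟨p, hp, hpf⟩ := (convex_segment (𝕜 := ℝ) x w).isPreconnected.inter_frontier_nonempty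
      ⟨x, left_mem_segment ℝ x w, hx⟩ ⟨w, right_mem_segment ℝ x w, hwΩ⟩
    rw [segment_eq_image'] at hp
    obtain ⟨s, hs, rfl⟩ := hp
    have h1 : ⟪B (y - x), y - x⟫ ≤ _ := hmin hpf
    rw [mem_ofPred_eq] at hw
    simp only [add_sub_cancel_left, form_smul] at h1
    have h2 := hB.form_nonneg hLam (w - x)
    nlinarith [hs.1, hs.2, mul_nonneg (mul_nonneg hs.1 (sub_nonneg.2 hs.2)) h2,
      mul_nonneg (sub_nonneg.2 hs.2) h2]

lemma HolderSemi.continuousOn {A : EucSp n → (EucSp n →L[ℝ] EucSp n)} {γ K : ℝ} (hγ : 0 < γ)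
    {s : Set (EucSp n)} (hA : HolderSemi A γ K s) : ContinuousOn A s := by
  intro x hx
  rw [ContinuousWithinAt, tendsto_iff_norm_sub_tendsto_zero]
  have h : Tendsto (fun y => K * ‖y - x‖ ^ γ) (𝓝[s] x) (𝓝 0) := by
    have hc : Continuous fun y : EucSp n => K * ‖y - x‖ ^ γ :=
      continuous_const.mul
        ((continuous_id.sub continuous_const).norm.rpow_const fun _ => Or.inr hγ.le)
    simpa [Real.zero_rpow hγ.ne'] using (hc.tendsto x).mono_left nhdsWithin_le_nhds
  exact squeeze_zero' (Eventually.of_forall fun _ => norm_nonneg _)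
    (eventually_nhdsWithin_of_forall fun y hy => hA y hy x hx) h

/-- On the ball of radius `τ` around `p`, the quadratic form of `B` stays close to its value
at `p`. -/
lemma form_le_of_mem_ball {A₀ B : EucSp n →L[ℝ] EucSp n} {lam Lam : ℝ}
    (hB : IsFormInverse A₀ B lam Lam) (hlam : 0 < lam) (hLam : 0 < Lam) {p z : EucSp n} {τ : ℝ}
    (hτ : τ ≤ 1) (hp : ⟪B p, p⟫ ≤ 1) (hz : z ∈ ball p τ) :
    ⟪B z, z⟫ ≤ ⟪B p, p⟫ + (2 * √Lam + 1) * τ / lam := by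
  rw [mem_ball, dist_eq_norm] at hz
  have hz0 := norm_nonneg (z - p)
  have e : ⟪B z, z⟫ = ⟪B p, p⟫ + 2 * ⟪B p, z - p⟫ + ⟪B (z - p), z - p⟫ := by
    have h1 : ⟪B (z - p), p⟫ = ⟪B p, z - p⟫ := by
      rw [hB.symm, real_inner_comm]
    have h2 : z = p + (z - p) := by abel
    conv_lhs => rw [h2]
    rw [map_add, inner_add_left, inner_add_right, inner_add_right, h1]
    ring
  have h1 : ⟪B p, z - p⟫ ≤ √Lam * τ / lam := by
    calc ⟪B p, z - p⟫ ≤ ‖B p‖ * ‖z - p‖ := real_inner_le_norm _ _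
      _ ≤ (√Lam / lam) * τ := by
          gcongr
          exact (hB.norm_le p).trans (by gcongr; exact hB.norm_le_sqrt hLam hp)
      _ = √Lam * τ / lam := by ring
  have h2 : ⟪B (z - p), z - p⟫ ≤ τ / lam := by
    refine (hB.form_le _).trans ?_
    gcongr
    nlinarith
  rw [e]
  have : (2 * √Lam + 1) * τ / lam = 2 * (√Lam * τ / lam) + τ / lam := by ring
  linarith

/-- Every point near the origin has a nearby point at which `v` is larger by a fixed factor. -/
lemma exists_growth_step {γ lam Lam K c L M : ℝ} (hγ : γ ∈ Ioo (0 : ℝ) 1) (hlam : 0 < lam)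
    (hlamLam : lam ≤ Lam) (hK : 0 ≤ K) (hc : 0 < c) (hL : 0 ≤ L) (hM : 0 ≤ M) :
    ∃ δ > (0 : ℝ), ∃ T > (0 : ℝ), ∃ ρ > (0 : ℝ), ρ ≤ 1 / 2 ∧
      ∀ (A : EucSp n → (EucSp n →L[ℝ] EucSp n)), IsElliptic A lam Lam (ball 0 1) →
      IsSymmCoeff A (ball 0 1) → HolderSemi A γ K (ball 0 1) →
      ∀ Ω : Set (EucSp n), IsOpen Ω → (0 : EucSp n) ∈ frontier Ω →
      ∀ f v : EucSp n → ℝ, (∀ x ∈ Ω ∩ ball 0 1, |f x| ≤ M) → LipschitzWith L.toNNReal v →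
      (∀ x ∈ frontier Ω ∩ ball (0 : EucSp n) 1, v x = 0) → WeakEq A v f (Ω ∩ ball 0 1) →
      (∀ x ∈ ball (0 : EucSp n) (1 / 2) ∩ Ω, c * infDist x (frontier Ω) ≤ v x) →
      ∀ x ∈ Ω, ‖x‖ < ρ →
        0 < v x ∧ ∃ x' ∈ Ω, (1 + δ) * v x ≤ v x' ∧ ‖x' - x‖ ≤ T * v x := by
  have hLam : 0 < Lam := hlam.trans_le hlamLam
  obtain ⟨b, hb0, hb⟩ := exists_capSlope_le
  set ell := √lam with hell
  have hl0 : 0 < ell := Real.sqrt_pos.2 hlam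
  have hl2 : ell ^ 2 = lam := Real.sq_sqrt hlam.le
  set S := √Lam with hS
  have hS0 : 0 < S := Real.sqrt_pos.2 hLam
  set a := c * ell with ha
  have ha0 : 0 < a := mul_pos hc hl0
  obtain ⟨σ, hσ0, hσ1, hσa⟩ : ∃ σ : ℝ, 0 < σ ∧ σ ≤ 1 / 2 ∧ L * (σ * (1 + 2 * S)) ≤ a / 2 := by
    refine ⟨min (1 / 2) (a / (2 * (L + 1) * (1 + 2 * S))), by positivity, min_le_left _ _, ?_⟩
    calc L * (min (1 / 2) (a / (2 * (L + 1) * (1 + 2 * S))) * (1 + 2 * S))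
        ≤ (L + 1) * (a / (2 * (L + 1) * (1 + 2 * S)) * (1 + 2 * S)) := by
          gcongr
          · linarith
          · exact min_le_right _ _
      _ = a / 2 := by field_simp
  obtain ⟨τ, hτ0, hτσ, hτ⟩ : ∃ τ : ℝ, 0 < τ ∧ τ ≤ σ ∧ (2 * S + 1) * τ / lam ≤ σ / 2 := by
    refine ⟨min σ (lam * σ / (2 * (2 * S + 1))), by positivity, min_le_left _ _, ?_⟩
    calc (2 * S + 1) * min σ (lam * σ / (2 * (2 * S + 1))) / lam
        ≤ (2 * S + 1) * (lam * σ / (2 * (2 * S + 1))) / lam := by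
          gcongr; exact min_le_right _ _
      _ = σ / 2 := by field_simp
  have hσ2 : (1 - σ) ^ 2 ≤ 1 - σ := by nlinarith
  obtain ⟨η, hη0, hη⟩ := exists_le_capSlope (s₁ := 1 - σ / 2) (by linarith)
  set κ := η * volume.real (ball (0 : EucSp n) τ) with hκ
  have hκ0 : 0 < κ :=
    mul_pos hη0 (ENNReal.toReal_pos (measure_ball_pos _ _ hτ0).ne' measure_ball_lt_top.ne)
  set I := b * volume.real (closedBall (0 : EucSp n) S) with hI
  have hI0 : 0 ≤ I := by positivity
  set C₁ := capConst n γ lam Lam K L M b with hC₁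
  obtain ⟨ε, hε0, hε⟩ : ∃ ε > 0, ∀ t, 0 < t → t < ε → C₁ * t ^ γ < a * κ / 4 := by
    have hcont : Continuous fun t : ℝ => C₁ * t ^ γ :=
      continuous_const.mul (continuous_id.rpow_const fun _ => Or.inr hγ.1.le)
    have hev : ∀ᶠ t in 𝓝 (0 : ℝ), C₁ * t ^ γ < a * κ / 4 := by
      refine (hcont.tendsto 0).eventually (gt_mem_nhds ?_)
      simp only [Real.zero_rpow hγ.1.ne', mul_zero]
      positivity
    obtain ⟨ε, hε0, h⟩ := Metric.eventually_nhds_iff.1 hev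
    exact ⟨ε, hε0, fun t h0 h1 => h (by simpa [abs_of_pos h0] using h1)⟩
  obtain ⟨ρ, hρ0, hρ1, hρε, hρ⟩ : ∃ ρ : ℝ, 0 < ρ ∧ ρ ≤ 1 / 2 ∧ ρ ≤ ell * min 1 ε ∧
      ρ + S * (ρ / ell) ≤ 1 := by
    refine ⟨min (1 / 2) (min (ell * min 1 ε) (1 / (1 + S / ell))), by positivity,
      min_le_left _ _, (min_le_right _ _).trans (min_le_left _ _), ?_⟩
    set ρ := min (1 / 2) (min (ell * min 1 ε) (1 / (1 + S / ell)))
    have h : ρ ≤ 1 / (1 + S / ell) := (min_le_right _ _).trans (min_le_right _ _)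
    rw [le_div_iff₀ (by positivity)] at h
    calc ρ + S * (ρ / ell) = ρ * (1 + S / ell) := by ring
      _ ≤ 1 := h
  refine ⟨κ / (4 * (I + 1)), by positivity, S / a, by positivity, ρ, hρ0, hρ1, ?_⟩
  intro A hell' hsymm hhol Ω hΩ h0 f v hf hv hv0 hw hnd x hxΩ hxρ
  have hx1 : x ∈ ball (0 : EucSp n) 1 := by rw [mem_ball_zero_iff]; linarith
  obtain ⟨B, hB⟩ := exists_isFormInverse hlam hLam (hell' x hx1) (hsymm x hx1)
  obtain ⟨d, hd0, y, hy, hyd, hmin, hsub⟩ := exists_touching_ellipsoid hB hLam hΩ ⟨0, h0⟩ hxΩ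
  have hdist : ∀ w ∈ frontier Ω, ell * d ≤ dist x w := by
    intro w hw
    have h := (hmin w hw).trans (hB.form_le _)
    rw [le_div_iff₀ hlam] at h
    rw [dist_comm, dist_eq_norm]
    refine (pow_le_pow_iff_left₀ (by positivity) (norm_nonneg _) two_ne_zero).1 ?_
    rw [mul_pow, hl2, mul_comm]
    exact h
  have hvx : a * d ≤ v x := by
    have h1 := (le_infDist ⟨0, h0⟩).2 hdist
    have h2 := hnd x ⟨by rw [mem_ball_zero_iff]; linarith, hxΩ⟩
    have h3 := mul_le_mul_of_nonneg_left h1 hc.le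
    rw [ha]
    linarith
  have hvx0 : 0 < v x := (mul_pos ha0 hd0).trans_le hvx
  have hld : ell * d < ρ := by
    have h := hdist 0 h0
    rw [dist_zero_right] at h
    linarith
  have hdm : d < min 1 ε := lt_of_mul_lt_mul_left (hld.trans_le hρε) hl0.le
  have hd1 : d < 1 := hdm.trans_le (min_le_left _ _)
  have hdε : d < ε := hdm.trans_le (min_le_right _ _)
  have hdρ : d ≤ ρ / ell := by rw [le_div_iff₀ hl0]; linarith
  have hnear : ∀ w, ⟪B (w - x), w - x⟫ ≤ d ^ 2 → w ∈ ball (0 : EucSp n) 1 := by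
    intro w hw
    have h1 : ‖d⁻¹ • (w - x)‖ ≤ S := by
      refine hB.norm_le_sqrt hLam ?_
      rw [form_smul, inv_pow, inv_mul_le_iff₀ (by positivity), mul_one]
      exact hw
    rw [norm_smul, norm_inv, Real.norm_of_nonneg hd0.le, inv_mul_le_iff₀ hd0] at h1
    have h2 : ‖w‖ ≤ ‖x‖ + ‖w - x‖ := by
      simpa using norm_add_le x (w - x)
    have h3 := mul_le_mul_of_nonneg_left hdρ hS0.le
    rw [mem_ball_zero_iff]
    linarith
  have hvy : v y = 0 := hv0 y ⟨hy, hnear y hyd.le⟩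
  have hLip : ∀ w, v w ≤ L * ‖w - y‖ := by
    intro w
    have h := hv.dist_le_mul w y
    rw [hvy, Real.dist_eq, sub_zero, Real.coe_toNNReal _ hL, dist_eq_norm] at h
    exact (le_abs_self _).trans h
  refine ⟨hvx0, ?_⟩
  by_contra! hcon
  set t := (1 - σ) * d with ht
  have ht0 : 0 < t := mul_pos (by linarith) hd0
  have htd : t < d := mul_lt_of_lt_one_left hd0 (by linarith)
  set D := Ω ∩ ball (0 : EucSp n) 1
  have hlow := abs_capMean_sub_le (n := n) (A := A) (B := B) (v := v) (f := f) (D := D) (x := x)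
    (L := L.toNNReal) (R := d) (t := t) (b := b) hγ hlam hLam hK hM hb0.le hb
    (hΩ.inter isOpen_ball) (isBounded_ball.subset inter_subset_right)
    ((hhol.continuousOn hγ.1).mono inter_subset_right)
    (fun z hz => hhol z hz.2 x hx1) hB hv hf hw
    (fun w hw => ⟨hsub hw, hnear w (le_of_lt hw)⟩) ht0 htd (by linarith)
  rw [Real.coe_toNNReal _ hL, ← hC₁] at hlow
  have hlow' := (abs_le.1 hlow).1
  have herr : C₁ * t ^ γ * t ≤ a * κ / 4 * t :=
    mul_le_mul_of_nonneg_right (hε t ht0 (htd.trans hdε)).le ht0.le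
  set zh := d⁻¹ • (y - x) with hzh
  have hqz : ⟪B zh, zh⟫ = 1 := by
    rw [hzh, form_smul, hyd, inv_pow, inv_mul_cancel₀ (by positivity)]
  have hnz : ‖zh‖ ≤ S := hB.norm_le_sqrt hLam hqz.le
  have hyx : y = x + d • zh := by
    rw [hzh, smul_smul, mul_inv_cancel₀ hd0.ne', one_smul, add_sub_cancel]
  have hup := capMean_le hB hLam hv.continuous (x := x) (p := (1 - σ) • zh) (t := t) (τ := τ)
    (U := (1 + κ / (4 * (I + 1))) * v x) (m := v x / 2) (a := η) (by linarith)
    (fun z hz => by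
      by_contra! hlt
      have hq : ⟪B (x + t • z - x), x + t • z - x⟫ < d ^ 2 := by
        rw [add_sub_cancel_left, form_smul]
        calc t ^ 2 * ⟪B z, z⟫ ≤ t ^ 2 * 1 := by gcongr
          _ < d ^ 2 := by rw [mul_one]; gcongr
      have h1 := hcon _ (hsub hq) hlt.le
      rw [add_sub_cancel_left, norm_smul, Real.norm_of_nonneg ht0.le] at h1
      have h2 : t * ‖z‖ ≤ d * S :=
        mul_le_mul htd.le (hB.norm_le_sqrt hLam hz.le) (norm_nonneg _) hd0.le
      have h3 : d * S ≤ S / a * v x := by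
        rw [div_mul_eq_mul_div, le_div_iff₀ ha0]
        linarith [mul_le_mul_of_nonneg_left hvx hS0.le]
      linarith)
    (fun z hz => by
      rw [mem_ball, dist_eq_norm] at hz
      have e : x + t • z - y = t • (z - (1 - σ) • zh) - (d * (σ * (2 - σ))) • zh := by
        rw [hyx, ht]
        module
      have h1 : ‖x + t • z - y‖ ≤ d * (σ * (1 + 2 * S)) := by
        rw [e]
        refine (norm_sub_le _ _).trans ?_
        rw [norm_smul, norm_smul, Real.norm_of_nonneg ht0.le,
          Real.norm_of_nonneg (mul_nonneg hd0.le (mul_nonneg hσ0.le (by linarith)))]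
        have h2 : t * ‖z - (1 - σ) • zh‖ ≤ d * σ :=
          mul_le_mul htd.le (hz.le.trans hτσ) (norm_nonneg _) hd0.le
        have h3 : d * (σ * (2 - σ)) * ‖zh‖ ≤ d * (σ * 2) * S := by
          gcongr
          linarith
        linarith
      have h4 := (hLip _).trans (mul_le_mul_of_nonneg_left h1 hL)
      have h5 := mul_le_mul_of_nonneg_left hσa hd0.le
      have h6 : 0 ≤ κ / (4 * (I + 1)) * v x := by positivity
      linarith)
    (fun z hz => by
      refine hη _ ⟨hB.form_nonneg hLam z, ?_⟩
      have hq : ⟪B ((1 - σ) • zh), (1 - σ) • zh⟫ = (1 - σ) ^ 2 := by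
        rw [form_smul, hqz, mul_one]
      have h1 := form_le_of_mem_ball hB hlam hLam (by linarith) (by linarith) hz
      linarith)
  rw [mul_assoc (v x / 2) η, ← hκ] at hup
  have hJ := integral_capSlope_le hB hLam hb0.le hb
  rw [← hI] at hJ
  set J := ∫ z, capSlope ⟪B z, z⟫
  have h1 : κ / (4 * (I + 1)) * J ≤ κ / 4 := by
    calc κ / (4 * (I + 1)) * J ≤ κ / (4 * (I + 1)) * (I + 1) := by
          gcongr; linarith
      _ = κ / 4 := by field_simp
  have h2 := mul_le_mul_of_nonneg_left h1 hvx0.le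
  have h3 : κ / 4 * (a * t) < κ / 4 * v x := by
    gcongr
    exact (mul_lt_mul_of_pos_left htd ha0).trans_le hvx
  linarith

lemma WeakEq.congr {A : EucSp n → (EucSp n →L[ℝ] EucSp n)} {u v f : EucSp n → ℝ}
    {D : Set (EucSp n)} (hD : IsOpen D) (h : EqOn u v D) (hu : WeakEq A u f D) :
    WeakEq A v f D := by
  intro φ hφ
  rw [← hu φ hφ]
  refine setIntegral_congr_fun hD.measurableSet fun x hx => ?_
  have h1 : u =ᶠ[𝓝 x] v := h.eventuallyEq_of_mem (hD.mem_nhds hx)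
  simp only [h1.gradient_eq]

/-- If `v` can be increased by a fixed factor `1 + δ` within distance `T v(x)` of every point `x`,
then `v` grows linearly away from a boundary zero. -/
lemma linear_growth_of_growth_step {Ω : Set (EucSp n)} (h0 : (0 : EucSp n) ∈ closure Ω)
    {v : EucSp n → ℝ} {δ T ρ r : ℝ} (hδ : 0 < δ) (hT : 0 < T) (hr : 0 < r) (hrρ : r ≤ ρ)
    (hbdd : BddAbove (v '' (ball 0 r ∩ Ω)))
    (hstep : ∀ x ∈ Ω, ‖x‖ < ρ →
      0 < v x ∧ ∃ x' ∈ Ω, (1 + δ) * v x ≤ v x' ∧ ‖x' - x‖ ≤ T * v x) :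
    δ / (4 * T * (1 + δ / 2)) * r ≤ sSup (v '' (ball 0 r ∩ Ω)) := by
  set α := δ / (2 * T) with hα
  have hα0 : 0 < α := by positivity
  have hαT : α * T = δ / 2 := by rw [hα]; field_simp
  obtain ⟨x₀, hx₀r, hx₀Ω⟩ : ∃ x₀ ∈ ball (0 : EucSp n) (r / 2), x₀ ∈ Ω :=
    mem_closure_iff.1 h0 _ isOpen_ball (mem_ball_self (by positivity))
  rw [mem_ball_zero_iff] at hx₀r
  have hv₀ := (hstep x₀ hx₀Ω (by linarith)).1
  set G : EucSp n → ℝ := fun x => v x - α * ‖x - x₀‖ with hG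
  have hGb : BddAbove (G '' (ball 0 r ∩ Ω)) := by
    obtain ⟨m, hm⟩ := hbdd
    refine ⟨m, ?_⟩
    rintro _ ⟨x, hx, rfl⟩
    have h1 := hm (mem_image_of_mem v hx)
    have h2 : 0 ≤ α * ‖x - x₀‖ := by positivity
    simp only [hG]
    linarith
  have hx₀m : x₀ ∈ ball (0 : EucSp n) r ∩ Ω :=
    ⟨by rw [mem_ball_zero_iff]; linarith, hx₀Ω⟩
  have hG₀ : G x₀ = v x₀ := by simp [hG]
  obtain ⟨x, hx, hxG, hxs⟩ : ∃ x ∈ ball (0 : EucSp n) r ∩ Ω, G x₀ ≤ G x ∧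
      sSup (G '' (ball 0 r ∩ Ω)) < G x + δ / 2 * v x₀ := by
    obtain ⟨_, ⟨x, hx, rfl⟩, hlt⟩ := exists_lt_of_lt_csSup (Set.Nonempty.image G ⟨x₀, hx₀m⟩)
      (sub_lt_self (sSup (G '' (ball 0 r ∩ Ω))) (by positivity : 0 < δ / 2 * v x₀))
    rcases le_total (G x₀) (G x) with h | h
    · exact ⟨x, hx, h, by linarith⟩
    · exact ⟨x₀, hx₀m, le_rfl, by linarith⟩
  have hvx : v x₀ + α * ‖x - x₀‖ ≤ v x := by
    rw [hG₀] at hxG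
    exact le_sub_iff_add_le.1 hxG
  have hxr : ‖x‖ < r := mem_ball_zero_iff.1 hx.1
  obtain ⟨-, x', hx'Ω, hx'v, hx'd⟩ := hstep x hx.2 (by linarith)
  have htri : ‖x' - x₀‖ ≤ ‖x' - x‖ + ‖x - x₀‖ := norm_sub_le_norm_sub_add_norm_sub _ _ _
  have hx'r : r ≤ ‖x'‖ := by
    by_contra! hlt
    have h1 := le_csSup hGb (mem_image_of_mem G ⟨mem_ball_zero_iff.2 hlt, hx'Ω⟩)
    have h2 := mul_le_mul_of_nonneg_left (htri.trans (add_le_add_left hx'd _)) hα0.le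
    have h3 : α * (T * v x) = δ / 2 * v x := by rw [← mul_assoc, hαT]
    have h4 : δ / 2 * v x₀ ≤ δ / 2 * v x := by
      gcongr
      have : 0 ≤ α * ‖x - x₀‖ := by positivity
      linarith
    simp only [hG] at h1 hxs
    linarith
  have hfar : r / 2 ≤ T * v x + ‖x - x₀‖ := by
    have : ‖x'‖ ≤ ‖x' - x₀‖ + ‖x₀‖ := by simpa using norm_add_le (x' - x₀) x₀
    linarith
  refine le_trans ?_ (le_csSup hbdd (mem_image_of_mem v hx))
  have e : δ / (4 * T * (1 + δ / 2)) * r = α * (r / 2) / (1 + δ / 2) := by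
    rw [hα]; field_simp; ring
  rw [e, div_le_iff₀ (by positivity)]
  have h1 := mul_le_mul_of_nonneg_left hfar hα0.le
  have h2 : α * (T * v x) = δ / 2 * v x := by rw [← mul_assoc, hαT]
  linarith

/-- **Lemma 5.1 (Linear growth from non-degeneracy).** -/
theorem linear_growth_from_nondegeneracy
    (n : ℕ) (hn : 2 ≤ n) (γ lam Lam K : ℝ)
    (hγ : γ ∈ Set.Ioo (0:ℝ) 1) (hlam : 0 < lam) (hlamLam : lam ≤ Lam) (hK : 0 < K)
    (c L M : ℝ) (hc : 0 < c) (hL : 0 ≤ L) (hM : 0 ≤ M) :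
    ∃ C > (0:ℝ), ∃ r₀ > (0:ℝ),
      ∀ (A : EucSp n → (EucSp n →L[ℝ] EucSp n)),
        IsElliptic A lam Lam (ball 0 1) → IsSymmCoeff A (ball 0 1) →
        HolderSemi A γ K (ball 0 1) →
        ∀ Ω : Set (EucSp n), IsOpen Ω → (0 : EucSp n) ∈ frontier Ω →
        ∀ f : EucSp n → ℝ, (∀ x ∈ Ω ∩ ball 0 1, |f x| ≤ M) →
        ∀ u : EucSp n → ℝ,
          LipschitzOnWith (Real.toNNReal L) u (closure Ω ∩ ball 0 1) →
          (∀ x ∈ frontier Ω ∩ ball (0 : EucSp n) 1, u x = 0) →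
          WeakEq A u f (Ω ∩ ball 0 1) →
          (∀ x ∈ ball (0 : EucSp n) (1/2) ∩ Ω, c * infDist x (frontier Ω) ≤ u x) →
          ∀ r : ℝ, 0 < r → r ≤ r₀ →
            C * r ≤ sSup (u '' (ball 0 r ∩ Ω)) := by
  obtain ⟨δ, hδ, T, hT, ρ, hρ, hρ1, hstep⟩ :=
    exists_growth_step (n := n) hγ hlam hlamLam hK.le hc hL hM
  refine ⟨δ / (4 * T * (1 + δ / 2)), by positivity, ρ, hρ, ?_⟩
  intro A hell hsymm hhol Ω hΩ h0 f hf u hu hu0 hw hnd r hr hrρ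
  obtain ⟨v, hv, huv⟩ := hu.extend_real
  have hΩc : Ω ∩ ball (0 : EucSp n) 1 ⊆ closure Ω ∩ ball 0 1 :=
    inter_subset_inter_left _ subset_closure
  have hv0 : ∀ x ∈ frontier Ω ∩ ball (0 : EucSp n) 1, v x = 0 := fun x hx => by
    rw [← huv ⟨frontier_subset_closure hx.1, hx.2⟩, hu0 x hx]
  have himg : u '' (ball 0 r ∩ Ω) = v '' (ball 0 r ∩ Ω) :=
    image_congr fun x hx => huv (hΩc ⟨hx.2, ball_subset_ball (by linarith) hx.1⟩)
  rw [himg]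
  refine linear_growth_of_growth_step (frontier_subset_closure h0) hδ hT hr hrρ ?_ ?_
  · exact (hv.isBounded_image (isBounded_ball.subset inter_subset_left)).bddAbove
  · refine hstep A hell hsymm hhol Ω hΩ h0 f v hf hv hv0
      (hw.congr (hΩ.inter isOpen_ball) (huv.mono hΩc)) fun x hx => ?_
    rw [← huv (hΩc ⟨hx.2, ball_subset_ball (by norm_num) hx.1⟩)]
    exact hnd x hx
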